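/- arXiv:2009.04954 — 2 statements merged into one kernel-verified Lean document; each statement's English description precedes it below -/
import Mathlib

section
/- Let b : ℝ → ℝ be nondecreasing on [0,1] with b(1) > 0, and for each integer i = 1, …, ⌈b(1)⌉ define B_i := inf { t ∈ [0,1] : b(t) > i - 1 }. Let n ∈ ℕ and x : Fin n → ℝ. Then the following are equivalent: (a) for every t ∈ [0,1], b(t) ≤ N_x(t); (b) for every i = 1, …, ⌈b(1)⌉, N_x(B_i) ≥ i. -/
/-- The first passage time `B_i = inf { t ∈ [0,1] : b t > i - 1 }`. -/
noncomputable def firstPassage (b : ℝ → ℝ) (i : ℕ) : ℝ :=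
  sInf {t | t ∈ Set.Icc (0:ℝ) 1 ∧ b t > (i : ℝ) - 1}

/-- `N_x t = #{j : x j ≤ t}`, the (scaled) empirical CDF of the sample `x`. -/
noncomputable def Nx {n : ℕ} (x : Fin n → ℝ) (t : ℝ) : ℕ :=
  (Finset.univ.filter fun j => x j ≤ t).card

theorem Nx_mono {n : ℕ} (x : Fin n → ℝ) : Monotone (Nx x) := fun _ _ hst =>
  Finset.card_le_card <| Finset.monotone_filter_right _ fun _ _ hj => hj.trans hst

/-- The empirical CDF is locally constant to the right of every point. -/
theorem eventually_nhdsGE_Nx_eq {n : ℕ} (x : Fin n → ℝ) (t : ℝ) :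
    ∀ᶠ s in nhdsWithin t (Set.Ici t), Nx x s = Nx x t := by
  have h : ∀ᶠ s in nhdsWithin t (Set.Ici t), ∀ j, x j ≤ s ↔ x j ≤ t := by
    refine Filter.eventually_all.2 fun j => ?_
    rcases le_or_gt (x j) t with hj | hj
    · filter_upwards [self_mem_nhdsWithin] with s hs
      exact iff_of_true (hj.trans hs) hj
    · filter_upwards [nhdsWithin_le_nhds (Iio_mem_nhds hj)] with s hs
      exact iff_of_false (not_le.2 hs) (not_le.2 hj)
  filter_upwards [h] with s hs
  simp only [Nx, hs]

theorem firstPassage_le {b : ℝ → ℝ} {i : ℕ} {t : ℝ} (ht : t ∈ Set.Icc (0:ℝ) 1)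
    (hbt : (i : ℝ) - 1 < b t) : firstPassage b i ≤ t :=
  csInf_le ⟨0, fun _ hs => hs.1.1⟩ ⟨ht, hbt⟩

/-- The level `i - 1` is exceeded arbitrarily close to the right of the first passage time. -/
theorem exists_lt_of_firstPassage_lt {b : ℝ → ℝ} {i : ℕ} {u : ℝ} (hb : (i : ℝ) - 1 < b 1)
    (hu : firstPassage b i < u) :
    ∃ t ∈ Set.Icc (0:ℝ) 1, (i : ℝ) - 1 < b t ∧ firstPassage b i ≤ t ∧ t < u := by
  have hne : {t | t ∈ Set.Icc (0:ℝ) 1 ∧ b t > (i : ℝ) - 1}.Nonempty := ⟨1, by simp, hb⟩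
  obtain ⟨t, ⟨ht, hbt⟩, htu⟩ := exists_lt_of_csInf_lt hne hu
  exact ⟨t, ht, hbt, firstPassage_le ht hbt, htu⟩

/-- For `b` nondecreasing on `[0,1]` with `b 1 > 0` and a sample
`x : Fin n → ℝ`: `(∀ t ∈ [0,1], b t ≤ N_x t) ↔ (∀ i = 1, …, ⌈b 1⌉, N_x (B i) ≥ i)`. -/
theorem stmt_3 (n : ℕ) (x : Fin n → ℝ)
    (b : ℝ → ℝ) (hb : MonotoneOn b (Set.Icc (0:ℝ) 1)) (hb1 : 0 < b 1) :
    (∀ t ∈ Set.Icc (0:ℝ) 1, b t ≤ (Nx x t : ℝ)) ↔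
      (∀ i : ℕ, 1 ≤ i → (i : ℤ) ≤ ⌈b 1⌉ → i ≤ Nx x (firstPassage b i)) := by
  constructor
  · intro h i _ hi
    have hib : (i : ℝ) - 1 < b 1 := by
      have := Int.le_ceil_iff.1 hi
      exact_mod_cast this
    obtain ⟨u, hu, hsub⟩ := mem_nhdsGE_iff_exists_Ico_subset.1
      (eventually_nhdsGE_Nx_eq x (firstPassage b i))
    obtain ⟨t, ht, hbt, hle, hlt⟩ := exists_lt_of_firstPassage_lt hib hu
    have hN : Nx x t = Nx x (firstPassage b i) := hsub ⟨hle, hlt⟩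
    have hlt' : (i : ℝ) < (Nx x (firstPassage b i) + 1 : ℕ) := by
      push_cast
      linarith [hN ▸ h t ht]
    exact Nat.lt_succ_iff.1 (Nat.cast_lt.1 hlt')
  · intro h t ht
    rcases le_or_gt (b t) 0 with h0 | h0
    · exact h0.trans (Nat.cast_nonneg _)
    have hlt : (⌈b t⌉₊ : ℝ) - 1 < b t := by linarith [Nat.ceil_lt_add_one h0.le]
    have hi : (⌈b t⌉₊ : ℤ) ≤ ⌈b 1⌉ := by
      rw [Int.natCast_ceil_eq_ceil h0.le]
      exact Int.ceil_mono (hb ht (by simp) ht.2)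
    calc b t ≤ (⌈b t⌉₊ : ℝ) := Nat.le_ceil _
      _ ≤ (Nx x t : ℝ) := Nat.cast_le.2 <|
        (h _ (Nat.one_le_ceil_iff.2 h0) hi).trans (Nx_mono x (firstPassage_le ht hlt))
end

section
/- Let μ be a Borel probability measure on ℝ whose cumulative distribution function F(t) := μ((-∞, t]) is continuous, let n ∈ ℕ, let s_1, …, s_n : ℝ → ℝ be order isomorphisms of ℝ (strictly increasing bijections with increasing inverses), and let s ∈ ℝ. Define the statistic S(x) := max_{i=1,…,n} s_i(F(x_(i))) for x : Fin n → ℝ. Then μ^n({ x : S(x) ≤ s }) = μ_n({ u : ∀ i, u_(i) ≤ s_i^{-1}(s) }), where μ^n is the n-fold product of μ. In particular, the null distribution of S is the one-sided non-crossing probability of an i.i.d. U[0,1] sample with respect to the bounds B_i = s_i^{-1}(s). -/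
open MeasureTheory

/-- The order statistics of the sample `x`: `orderStat x i` is the `(i+1)`-st
smallest entry of `x` (0-based indexing). -/
noncomputable def orderStat {n : ℕ} (x : Fin n → ℝ) : Fin n → ℝ :=
  x ∘ Tuple.sort x

/-- The law of an i.i.d. sample of `n` uniform `U[0,1]` random variables. -/
noncomputable def unifn (n : ℕ) : Measure (Fin n → ℝ) :=
  Measure.pi fun _ => volume.restrict (Set.Icc (0:ℝ) 1)

theorem monotone_measure_Iic_toReal (μ : Measure ℝ) [IsProbabilityMeasure μ] :
    Monotone fun t => (μ (Set.Iic t)).toReal :=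
  fun _ _ h => ENNReal.toReal_mono (measure_ne_top _ _) (measure_mono (Set.Iic_subset_Iic.2 h))

/-- A continuous CDF attains every value in `(0, 1)`. -/
theorem exists_measure_Iic_eq (μ : Measure ℝ) [IsProbabilityMeasure μ]
    (hF : Continuous fun t => (μ (Set.Iic t)).toReal) {b : ℝ} (hb : b ∈ Set.Ioo (0 : ℝ) 1) :
    ∃ t, (μ (Set.Iic t)).toReal = b := by
  have hcdf : ∀ t, (μ (Set.Iic t)).toReal = ProbabilityTheory.cdf μ t :=
    fun t => (ProbabilityTheory.cdf_eq_real μ t).symm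
  simp_rw [hcdf] at hF ⊢
  exact mem_range_of_exists_le_of_exists_ge hF
    ((ProbabilityTheory.tendsto_cdf_atBot μ).eventually (eventually_le_nhds hb.1)).exists
    ((ProbabilityTheory.tendsto_cdf_atTop μ).eventually (eventually_ge_nhds hb.2)).exists

theorem toReal_measure_setOf_measure_Iic_le (μ : Measure ℝ) [IsProbabilityMeasure μ]
    (hF : Continuous fun t => (μ (Set.Iic t)).toReal) {a : ℝ} (ha : a ∈ Set.Ico (0 : ℝ) 1) :
    (μ {x | (μ (Set.Iic x)).toReal ≤ a}).toReal = a := by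
  apply le_antisymm
  · refine le_of_forall_gt_imp_ge_of_dense fun b hab => ?_
    rcases le_or_gt 1 b with hb | hb
    · exact measureReal_le_one.trans hb
    obtain ⟨t, rfl⟩ := exists_measure_Iic_eq μ hF ⟨ha.1.trans_lt hab, hb⟩
    refine ENNReal.toReal_mono (measure_ne_top _ _) (measure_mono fun x hx => ?_)
    exact ((monotone_measure_Iic_toReal μ).reflect_lt (lt_of_le_of_lt hx hab)).le
  · rcases ha.1.eq_or_lt with rfl | ha0
    · exact ENNReal.toReal_nonneg
    obtain ⟨t, rfl⟩ := exists_measure_Iic_eq μ hF ⟨ha0, ha.2⟩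
    exact ENNReal.toReal_mono (measure_ne_top _ _)
      (measure_mono fun x hx => monotone_measure_Iic_toReal μ hx)

/-- The probability integral transform. -/
theorem map_measure_Iic_eq_uniform (μ : Measure ℝ) [IsProbabilityMeasure μ]
    (hF : Continuous fun t => (μ (Set.Iic t)).toReal) :
    μ.map (fun t => (μ (Set.Iic t)).toReal) = volume.restrict (Set.Icc (0 : ℝ) 1) := by
  have : IsProbabilityMeasure (μ.map fun t => (μ (Set.Iic t)).toReal) :=
    Measure.isProbabilityMeasure_map hF.aemeasurable
  refine Measure.ext_of_Iic _ _ fun a => ?_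
  rw [Measure.map_apply hF.measurable measurableSet_Iic, Measure.restrict_apply measurableSet_Iic]
  change μ {x | (μ (Set.Iic x)).toReal ≤ a} = _
  rcases lt_or_ge a 0 with h0 | h0
  · have h₁ : {x | (μ (Set.Iic x)).toReal ≤ a} = ∅ :=
      Set.eq_empty_of_forall_notMem fun x hx =>
        absurd (ENNReal.toReal_nonneg.trans hx) (not_le.2 h0)
    have h₂ : Set.Iic a ∩ Set.Icc 0 1 = ∅ :=
      Set.eq_empty_of_forall_notMem fun x hx => absurd (hx.2.1.trans hx.1) (not_le.2 h0)
    rw [h₁, h₂, measure_empty, measure_empty]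
  rcases le_or_gt 1 a with h1 | h1
  · have h₁ : {x | (μ (Set.Iic x)).toReal ≤ a} = Set.univ :=
      Set.eq_univ_of_forall fun x => measureReal_le_one.trans h1
    have h₂ : Set.Iic a ∩ Set.Icc 0 1 = Set.Icc 0 1 :=
      Set.inter_eq_right.2 fun x hx => hx.2.trans h1
    rw [h₁, h₂, measure_univ, Real.volume_Icc, sub_zero, ENNReal.ofReal_one]
  · have h₂ : Set.Iic a ∩ Set.Icc 0 1 = Set.Icc 0 a := by
      ext x
      exact ⟨fun hx => ⟨hx.2.1, hx.1⟩, fun hx => ⟨hx.2, hx.1, hx.2.trans h1.le⟩⟩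
    rw [h₂, Real.volume_Icc, sub_zero, ← ENNReal.ofReal_toReal (measure_ne_top μ _),
      toReal_measure_setOf_measure_Iic_le μ hF ⟨h0, h1⟩]

theorem orderStat_comp_of_monotone {n : ℕ} {f : ℝ → ℝ} (hf : Monotone f) (x : Fin n → ℝ) :
    orderStat (f ∘ x) = f ∘ orderStat x :=
  (Tuple.comp_sort_eq_comp_iff_monotone (f := f ∘ x) |>.2 (hf.comp (Tuple.monotone_sort x))).symm

theorem orderStat_le_iff {n : ℕ} (x : Fin n → ℝ) (i : Fin n) (c : ℝ) :
    orderStat x i ≤ c ↔ ∃ A : Finset (Fin n), (i : ℕ) < A.card ∧ ∀ j ∈ A, x j ≤ c := by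
  have hcard : (Finset.univ.filter fun j => orderStat x j ≤ c).card =
      (Finset.univ.filter fun j => x j ≤ c).card :=
    Finset.card_equiv (Tuple.sort x) fun j => by
      rw [Finset.mem_filter, Finset.mem_filter]
      simp [orderStat]
  have hmono : Monotone (orderStat x) := Tuple.monotone_sort x
  rw [← Tuple.lt_card_le_iff_apply_le_of_monotone hmono, hcard]
  refine ⟨fun h => ⟨_, h, fun j hj => (Finset.mem_filter.1 hj).2⟩, fun ⟨A, hA, h⟩ => ?_⟩
  exact hA.trans_le (Finset.card_le_card fun j hj => Finset.mem_filter.2 ⟨Finset.mem_univ j, h j hj⟩)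

theorem measurableSet_orderStat_le {n : ℕ} (i : Fin n) (c : ℝ) :
    MeasurableSet {x : Fin n → ℝ | orderStat x i ≤ c} := by
  simp_rw [orderStat_le_iff]
  measurability

/-- For a Borel probability measure `μ` on `ℝ` with continuous CDF
`F t = μ (-∞, t]`, order isomorphisms `s i : ℝ ≃o ℝ` and `sv : ℝ`, with the
statistic `S x := max_i s i (F (x_(i)))`:
`μⁿ {x : S x ≤ sv} = P(∀ i, U_(i) ≤ (s i)⁻¹ sv)` for an i.i.d. `U[0,1]` sample. -/
theorem stmt_16 (μ : Measure ℝ) [IsProbabilityMeasure μ]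
    (hF : Continuous fun t => (μ (Set.Iic t)).toReal)
    (n : ℕ) (hn : 0 < n) (s : Fin n → (ℝ ≃o ℝ)) (sv : ℝ) :
    (Measure.pi fun _ : Fin n => μ)
      {x | Finset.univ.sup'
          (Finset.univ_nonempty_iff.mpr (Fin.pos_iff_nonempty.mp hn))
          (fun i => s i ((μ (Set.Iic (orderStat x i))).toReal)) ≤ sv} =
      unifn n {u | ∀ i : Fin n, orderStat u i ≤ (s i).symm sv} := by
  have hset : {x : Fin n → ℝ | Finset.univ.sup'
        (Finset.univ_nonempty_iff.mpr (Fin.pos_iff_nonempty.mp hn))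
        (fun i => s i ((μ (Set.Iic (orderStat x i))).toReal)) ≤ sv} =
      (fun x i => (μ (Set.Iic (x i))).toReal) ⁻¹'
        {u | ∀ i : Fin n, orderStat u i ≤ (s i).symm sv} := by
    ext x
    have hx := orderStat_comp_of_monotone (monotone_measure_Iic_toReal μ) x
    change _ ↔ ∀ i, orderStat ((fun t => (μ (Set.Iic t)).toReal) ∘ x) i ≤ (s i).symm sv
    simp [hx, OrderIso.le_symm_apply]
  have hmeas : MeasurableSet {u : Fin n → ℝ | ∀ i : Fin n, orderStat u i ≤ (s i).symm sv} := by
    rw [Set.ofPred_forall]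
    exact MeasurableSet.iInter fun i => measurableSet_orderStat_le i _
  have : IsProbabilityMeasure (μ.map fun t => (μ (Set.Iic t)).toReal) :=
    Measure.isProbabilityMeasure_map hF.aemeasurable
  rw [hset, unifn, ← map_measure_Iic_eq_uniform μ hF,
    ← Measure.pi_map_pi fun _ => hF.aemeasurable]
  exact (Measure.map_apply
    (measurable_pi_lambda _ fun i => hF.measurable.comp (measurable_pi_apply i)) hmeas).symm
end
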